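/- arXiv:2008.00543 — 3 statements merged into one kernel-verified Lean document; each statement's English description precedes it below -/
import Mathlib

section
/- Let G be a simple real Lie group with dim G > 3, with Lie algebra 𝔤 and Lorentzian left-invariant metric B. If z ∈ 𝔤 is nonzero with ad_z skew-symmetric with respect to B, then ad_z is not nilpotent. -/
/-- A symmetric bilinear form is Lorentzian: nondegenerate, symmetric, admits a timelike
vector, and every subspace on which it is negative definite has dimension at most 1
(i.e. it has index 1). -/
def IsLorentzian {V : Type*} [AddCommGroup V] [Module ℝ V]
    (B : LinearMap.BilinForm ℝ V) : Prop :=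
  B.Nondegenerate ∧ (∀ x y : V, B x y = B y x) ∧ (∃ x : V, B x x < 0) ∧
    ∀ W : Submodule ℝ V, (∀ w ∈ W, w ≠ 0 → B w w < 0) → Module.finrank ℝ W ≤ 1

section Lorentzian

variable {V : Type*} [AddCommGroup V] [Module ℝ V] {B : LinearMap.BilinForm ℝ V}

lemma IsLorentzian.exists_apply_ne_zero (hB : IsLorentzian B) {x : V} (hx : x ≠ 0) :
    ∃ y, B x y ≠ 0 := by
  by_contra! h
  exact hx (hB.1.1 x h)

lemma IsLorentzian.nonneg_of_orthogonal_timelike (hB : IsLorentzian B) {t y : V}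
    (ht : B t t < 0) (hty : B t y = 0) : 0 ≤ B y y := by
  by_contra! hy
  have hyt : B y t = 0 := by rw [hB.2.1, hty]
  have hval (p q : ℝ) : B (p • t + q • y) (p • t + q • y) = p ^ 2 * B t t + q ^ 2 * B y y := by
    simp only [map_add, map_smul, LinearMap.add_apply, LinearMap.smul_apply, smul_eq_mul, hty, hyt]
    ring
  have hli : LinearIndependent ℝ ![t, y] := by
    rw [LinearIndependent.pair_iff]
    intro p q h
    have h0 := hval p q
    rw [h, map_zero] at h0
    constructor
    · by_contra hp
      have := mul_pos_of_neg_of_neg ht (neg_lt_zero.2 (pow_pos (abs_pos.2 hp) 2))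
      rw [sq_abs] at this
      nlinarith [sq_nonneg q]
    · by_contra hq
      have := mul_pos_of_neg_of_neg hy (neg_lt_zero.2 (pow_pos (abs_pos.2 hq) 2))
      rw [sq_abs] at this
      nlinarith [sq_nonneg p]
  have hle := hB.2.2.2 (Submodule.span ℝ (Set.range ![t, y])) (by
    intro w hw hw0
    simp only [Matrix.range_cons, Matrix.range_empty, Set.union_empty,
      Set.singleton_union] at hw
    obtain ⟨p, q, rfl⟩ := Submodule.mem_span_pair.1 hw
    rw [hval]
    by_cases hp : p = 0
    · have hq : q ≠ 0 := by
        rintro rfl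
        simp [hp] at hw0
      have := sq_pos_of_ne_zero hq
      subst hp
      nlinarith
    · have := sq_pos_of_ne_zero hp
      nlinarith [sq_nonneg q])
  rw [finrank_span_eq_card hli] at hle
  simp at hle

lemma IsLorentzian.pos_of_orthogonal_timelike (hB : IsLorentzian B) {t y : V}
    (ht : B t t < 0) (hty : B t y = 0) (hy : y ≠ 0) : 0 < B y y := by
  refine lt_of_le_of_ne (hB.nonneg_of_orthogonal_timelike ht hty) fun h0 => ?_
  obtain ⟨w, hw⟩ := hB.exists_apply_ne_zero hy
  have hyt : B y t = 0 := by rw [hB.2.1, hty]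
  set w' := w - (B t w / B t t) • t with hw'
  have htw : B t w' = 0 := by
    rw [hw', map_sub, map_smul, smul_eq_mul, div_mul_cancel₀ _ ht.ne, sub_self]
  have hyw : B y w' ≠ 0 := by
    simpa [hw', hyt] using hw
  have hneg := hB.nonneg_of_orthogonal_timelike (y := w' - ((B w' w' + 1) / (2 * B y w')) • y) ht
    (by simp [htw, hty])
  have hval : B (w' - ((B w' w' + 1) / (2 * B y w')) • y)
      (w' - ((B w' w' + 1) / (2 * B y w')) • y) = -1 := by
    simp only [map_sub, map_smul, LinearMap.sub_apply, LinearMap.smul_apply, smul_eq_mul, ← h0,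
      hB.2.1 w' y]
    field_simp
    ring
  linarith

/-- A vector orthogonal to a nonzero null vector is either spacelike or a multiple of it. -/
lemma IsLorentzian.exists_eq_smul_of_orthogonal_null (hB : IsLorentzian B) {u x : V}
    (hu : u ≠ 0) (huu : B u u = 0) (hux : B u x = 0) (hxx : B x x ≤ 0) : ∃ c : ℝ, x = c • u := by
  obtain ⟨t, ht⟩ := hB.2.2.1
  have htu : B t u ≠ 0 := fun h => (hB.pos_of_orthogonal_timelike ht h hu).ne' huu
  have hxu : B x u = 0 := by rw [hB.2.1, hux]
  have hzero : B t u • x - B t x • u = 0 := by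
    by_contra hne
    have hpos := hB.pos_of_orthogonal_timelike ht (by simp; ring) hne
    simp only [map_sub, map_smul, LinearMap.sub_apply, LinearMap.smul_apply, smul_eq_mul, huu, hux,
      hxu] at hpos
    nlinarith [mul_self_nonneg (B t u)]
  refine ⟨B t x / B t u, ?_⟩
  rw [div_eq_inv_mul, mul_smul, ← sub_eq_zero.1 hzero, inv_smul_smul₀ htu]

variable {D : Module.End ℝ V}

lemma apply_pow_eq_of_skew (hD : ∀ x y, B (D x) y + B x (D y) = 0) (k : ℕ) (x y : V) :
    B ((D ^ k) x) y = (-1) ^ k * B x ((D ^ k) y) := by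
  induction k generalizing x y with
  | zero => simp
  | succ k ih =>
    rw [pow_succ, Module.End.mul_apply, ih, eq_neg_of_add_eq_zero_left (hD x _), ← pow_succ,
      pow_succ' D, Module.End.mul_apply]
    ring

lemma IsLorentzian.pow_three_eq_zero_of_skew (hB : IsLorentzian B)
    (hD : ∀ x y, B (D x) y + B x (D y) = 0) (hnil : IsNilpotent D) : D ^ 3 = 0 := by
  obtain ⟨k, hk⟩ := hnil
  induction k with
  | zero => rw [pow_zero] at hk; rw [← mul_one (D ^ 3), hk, mul_zero]
  | succ k ih =>
    by_cases hk3 : k + 1 ≤ 3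
    · exact pow_eq_zero_of_le hk3 hk
    refine ih (LinearMap.ext fun a => ?_)
    by_contra hu
    obtain ⟨j, rfl⟩ : ∃ j, k = j + 1 := ⟨k - 1, by omega⟩
    have horth (p q : ℕ) (hpq : j + 2 ≤ p + q) : B ((D ^ p) a) ((D ^ q) a) = 0 := by
      rw [apply_pow_eq_of_skew hD, ← Module.End.mul_apply, ← pow_add, pow_eq_zero_of_le hpq hk]
      simp
    obtain ⟨c, hc⟩ := hB.exists_eq_smul_of_orthogonal_null hu (horth _ _ (by omega))
      (horth (j + 1) j (by omega)) (horth j j (by omega)).le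
    apply hu
    have hzero : D ((D ^ (j + 1)) a) = 0 := by
      rw [← Module.End.mul_apply, ← pow_succ', hk, LinearMap.zero_apply]
    rw [pow_succ', Module.End.mul_apply, hc, map_smul, hzero, smul_zero, LinearMap.zero_apply]

/-- A nonzero nilpotent skew endomorphism of a Lorentzian space is a single Jordan block of size
three, up to a trivial summand. -/
lemma IsLorentzian.exists_jordan_chain_of_skew (hB : IsLorentzian B)
    (hD : ∀ x y, B (D x) y + B x (D y) = 0) (hnil : IsNilpotent D) (hD0 : D ≠ 0) :
    ∃ a, D (D a) ≠ 0 ∧ D (D (D a)) = 0 ∧ ∀ x, ∃ p q : ℝ, D x = p • D a + q • D (D a) := by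
  have hD3 (x : V) : D (D (D x)) = 0 := by
    simpa [pow_succ] using LinearMap.congr_fun (hB.pow_three_eq_zero_of_skew hD hnil) x
  have hsk (x y : V) : B (D x) y = -B x (D y) := eq_neg_of_add_eq_zero_left (hD x y)
  have hex : ∃ a, D (D a) ≠ 0 := by
    by_contra! h2
    obtain ⟨a, ha⟩ : ∃ a, D a ≠ 0 := by
      by_contra! h
      exact hD0 (LinearMap.ext h)
    obtain ⟨y, hy⟩ := hB.exists_apply_ne_zero ha
    obtain ⟨c, hc⟩ := hB.exists_eq_smul_of_orthogonal_null (x := D y) ha (by simp [hsk, h2])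
      (by simp [hsk, h2]) (by simp [hsk, h2])
    have haa := hD a a
    rw [hB.2.1 (D a) a] at haa
    apply hy
    rw [hsk, hc, map_smul, smul_eq_mul]
    rw [show B a (D a) = 0 by linarith]
    simp
  obtain ⟨a, ha⟩ := hex
  have hnn : B (D (D a)) (D (D a)) = 0 := by simp [hsk, hD3]
  have hpos : B (D a) (D a) ≠ 0 := by
    intro h
    obtain ⟨c, hc⟩ := hB.exists_eq_smul_of_orthogonal_null (x := D a) ha hnn (by simp [hsk, hD3])
      h.le
    apply ha
    rw [hc, map_smul, hD3, smul_zero]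
  refine ⟨a, ha, hD3 a, fun x => ?_⟩
  set s := B (D x) (D a) / B (D a) (D a) with hs
  set x' := x - s • a with hx'
  have hx'n : B x' (D (D a)) = 0 := by
    have : B (D x') (D a) = 0 := by
      rw [hx', map_sub, map_smul, map_sub, map_smul, LinearMap.sub_apply, LinearMap.smul_apply,
        smul_eq_mul, hs, div_mul_cancel₀ _ hpos, sub_self]
    rw [hsk] at this
    linarith
  obtain ⟨c, hc⟩ := hB.exists_eq_smul_of_orthogonal_null (x := D (D x')) ha hnn
    (by simp [hsk, hD3]) (by simp [hsk, hD3])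
  obtain ⟨q, hq⟩ := hB.exists_eq_smul_of_orthogonal_null (x := D x') ha hnn
    (by simp [hsk, hD3]) (by rw [hsk, hc, map_smul, hx'n]; simp)
  refine ⟨s, q, ?_⟩
  rw [← hq, hx', map_sub, map_smul]
  abel

end Lorentzian

section Lie

variable {K L : Type*} [Field K] [LieRing L] [LieAlgebra K L]

/-- In a simple Lie algebra, a subspace that contains a nonzero vector and is stable under
brackets is everything. -/
lemma LieAlgebra.IsSimple.span_eq_top [LieAlgebra.IsSimple K L] {s : Set L} {y : L}
    (hy : y ∈ s) (hy0 : y ≠ 0) (h : ∀ x : L, ∀ m ∈ s, ⁅x, m⁆ ∈ Submodule.span K s) :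
    Submodule.span K s = ⊤ := by
  let I : LieIdeal K L :=
    { Submodule.span K s with
      lie_mem := by
        intro x m hm
        refine Submodule.span_induction (p := fun m _ => ⁅x, m⁆ ∈ Submodule.span K s)
          (h x) (by simp) (fun _ _ _ _ h₁ h₂ => ?_) (fun c _ _ h₁ => ?_) hm
        · rw [lie_add]
          exact add_mem h₁ h₂
        · rw [lie_smul]
          exact Submodule.smul_mem _ c h₁ }
  have hyI : y ∈ I := Submodule.subset_span (R := K) hy
  rcases LieAlgebra.IsSimple.eq_bot_or_eq_top (R := K) I with hI | hI
  · rw [hI, LieSubmodule.mem_bot] at hyI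
    exact absurd hyI hy0
  · exact congrArg LieSubmodule.toSubmodule hI

lemma LieAlgebra.IsSimple.exists_normalized_of_jordan_chain [LieAlgebra.IsSimple K L]
    (hdim : 1 < Module.finrank K L) {z a : L} (hn0 : ⁅z, ⁅z, a⁆⁆ ≠ 0) (hn : ⁅z, ⁅z, ⁅z, a⁆⁆⁆ = 0)
    (hrange : ∀ x, ∃ p q : K, ⁅z, x⁆ = p • ⁅z, a⁆ + q • ⁅z, ⁅z, a⁆⁆) :
    ∃ n h b : L, n ≠ 0 ∧ ⁅h, n⁆ = n ∧ ⁅b, n⁆ = h ∧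
      ∀ x, ∃ p q : K, ⁅n, x⁆ = p • h + q • n := by
  set e := ⁅z, a⁆ with he
  set n := ⁅z, e⁆ with hne
  obtain ⟨l, μ, hl⟩ := hrange ⁅a, e⁆
  have han : ⁅a, n⁆ = l • e + μ • n := by
    rw [← hl, leibniz_lie z a e, ← he, ← hne, lie_self, zero_add]
  have hen : ⁅e, n⁆ = l • n := by
    have := leibniz_lie z a n
    rw [hn, lie_zero, add_zero, ← he, han, lie_add, lie_smul, lie_smul, hn, ← hne, smul_zero,
      add_zero] at this
    exact this.symm
  have hxn (x : L) : ∃ p q : K, ⁅x, n⁆ = (p * l) • e + q • n := by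
    obtain ⟨p, q, hpq⟩ := hrange x
    set k := x - p • a - q • e with hk
    have hzk : ⁅z, k⁆ = 0 := by
      rw [hk, lie_sub, lie_sub, lie_smul, lie_smul, hpq, ← he, ← hne]
      abel
    obtain ⟨p', q', hpq'⟩ := hrange ⁅k, a⁆
    have hke : ⁅k, e⁆ = p' • e + q' • n := by
      rw [← hpq', leibniz_lie z k a, hzk, zero_lie, zero_add]
    have hkn : ⁅k, n⁆ = p' • n := by
      have := leibniz_lie z k e
      rw [hzk, zero_lie, zero_add, ← hne, hke, lie_add, lie_smul, lie_smul, hn, smul_zero,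
        add_zero, ← hne] at this
      exact this.symm
    refine ⟨p, p * μ + q * l + p', ?_⟩
    rw [show x = k + p • a + q • e by rw [hk]; abel, add_lie, add_lie, smul_lie, smul_lie, han,
      hen, hkn]
    module
  have hl0 : l ≠ 0 := by
    rintro rfl
    have htop := span_eq_top (K := K) (Set.mem_singleton n) hn0 (by
      rintro x _ rfl
      obtain ⟨p, q, h⟩ := hxn x
      rw [h, mul_zero, zero_smul, zero_add]
      exact Submodule.smul_mem _ _ (Submodule.mem_span_singleton_self _))
    have hle := finrank_span_singleton (K := K) hn0
    rw [htop, finrank_top] at hle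
    omega
  refine ⟨n, l⁻¹ • e + (l⁻¹ * l⁻¹ * μ) • n, (l⁻¹ * l⁻¹) • a, hn0, ?_, ?_, fun x => ?_⟩
  · rw [add_lie, smul_lie, smul_lie, lie_self, hen, smul_zero, add_zero, inv_smul_smul₀ hl0]
  · rw [smul_lie, han, smul_add, smul_smul, smul_smul, mul_assoc, inv_mul_cancel₀ hl0, mul_one]
  · obtain ⟨p, q, h⟩ := hxn x
    refine ⟨-(p * l * l), -q + p * μ, ?_⟩
    rw [← lie_skew, h]
    match_scalars
    · field_simp
    · field_simp
      ring

variable [CharZero K]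

/-- If `ad n` has range spanned by `h` and `n`, then `n` and `h` complete to a three-dimensional
ideal. -/
lemma exists_span_triple_ideal {n h b : L} (hn0 : n ≠ 0) (hhn : ⁅h, n⁆ = n) (hbn : ⁅b, n⁆ = h)
    (hrange : ∀ x, ∃ p q : K, ⁅n, x⁆ = p • h + q • n) :
    ∃ a : L, ∀ x : L, ∀ m ∈ ({a, h, n} : Set L), ⁅x, m⁆ ∈ Submodule.span K {a, h, n} := by
  have hnh : ⁅n, h⁆ = -n := by rw [← lie_skew, hhn]
  have hcent {c : L} (hc : ⁅n, c⁆ = 0) : ∃ γ : K, ⁅h, c⁆ = γ • n := by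
    obtain ⟨p, q, hpq⟩ := hrange ⁅b, c⁆
    have hhc : ⁅h, c⁆ = -(p • h + q • n) := by
      rw [← hpq, ← hbn, lie_lie, hc, lie_zero, zero_sub]
    have h0 : ⁅n, ⁅h, c⁆⁆ = 0 := by
      rw [leibniz_lie, hc, hnh, neg_lie, hc, lie_zero, neg_zero, add_zero]
    rw [hhc, lie_neg, lie_add, lie_smul, lie_smul, lie_self, hnh, smul_zero, add_zero, smul_neg,
      neg_neg] at h0
    have hp := (smul_eq_zero.1 h0).resolve_right hn0
    exact ⟨-q, by rw [hhc, hp]; module⟩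
  set c₀ := ⁅b, h⁆ - b with hc₀
  have hnb : ⁅n, b⁆ = -h := by rw [← lie_skew, hbn]
  have hnc₀ : ⁅n, c₀⁆ = 0 := by
    rw [hc₀, lie_sub, leibniz_lie, hnb, hnh, neg_lie, lie_self, lie_neg, hbn]
    abel
  obtain ⟨γ, hγ⟩ := hcent hnc₀
  set a := b + c₀ - (γ / 2) • n with ha
  have hna : ⁅n, a⁆ = -h := by
    rw [ha, lie_sub, lie_add, lie_smul, hnb, hnc₀, lie_self]
    simp
  have hha : ⁅h, a⁆ = -a := by
    have hhb : ⁅h, b⁆ = -(b + c₀) := by rw [← lie_skew, hc₀]; abel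
    rw [ha, lie_sub, lie_add, lie_smul, hhn, hγ, hhb]
    module
  have hac {c : L} (hnc : ⁅n, c⁆ = 0) (hhc : ⁅h, c⁆ = 0) : ⁅a, c⁆ = 0 := by
    have h1 : ⁅n, ⁅a, c⁆⁆ = 0 := by
      rw [leibniz_lie, hna, hnc, neg_lie, hhc, lie_zero, neg_zero, add_zero]
    obtain ⟨δ, hδ⟩ := hcent h1
    have h2 : ⁅h, ⁅a, c⁆⁆ = -⁅a, c⁆ := by
      rw [leibniz_lie, hha, hhc, neg_lie, lie_zero, add_zero]
    have h3 : ⁅a, c⁆ = (-δ) • n := by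
      rw [neg_smul, ← hδ, h2, neg_neg]
    rw [h3, lie_smul, hhn] at hδ
    have h4 : (2 * δ) • n = 0 := by
      rw [two_mul, add_smul]
      nth_rewrite 1 [← hδ]
      module
    have hδ0 : δ = 0 := by simpa [hn0] using h4
    rw [h3, hδ0, neg_zero, zero_smul]
  refine ⟨a, fun x m hm => ?_⟩
  obtain ⟨p, q, hpq⟩ := hrange x
  have hnc : ⁅n, x + p • a + q • h⁆ = 0 := by
    rw [lie_add, lie_add, lie_smul, lie_smul, hpq, hna, hnh]
    module
  obtain ⟨δ, hδ⟩ := hcent hnc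
  set c := x + p • a + q • h - δ • n with hc
  have hnc' : ⁅n, c⁆ = 0 := by rw [hc, lie_sub, hnc, lie_smul, lie_self, smul_zero, sub_zero]
  have hhc : ⁅h, c⁆ = 0 := by rw [hc, lie_sub, hδ, lie_smul, hhn, sub_self]
  have hzero : ⁅c, m⁆ = 0 := by
    rw [← lie_skew, neg_eq_zero]
    rcases hm with rfl | rfl | rfl
    exacts [hac hnc' hhc, hhc, hnc']
  have hx : x = c - p • a - q • h + δ • n := by rw [hc]; abel
  have hamem : a ∈ Submodule.span K {a, h, n} := Submodule.subset_span (by simp)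
  have hhmem : h ∈ Submodule.span K {a, h, n} := Submodule.subset_span (by simp)
  have hnmem : n ∈ Submodule.span K {a, h, n} := Submodule.subset_span (by simp)
  have han : ⁅a, n⁆ = h := by rw [← lie_skew, hna, neg_neg]
  have hah : ⁅a, h⁆ = a := by rw [← lie_skew, hha, neg_neg]
  rw [hx, add_lie, sub_lie, sub_lie, smul_lie, smul_lie, smul_lie, hzero]
  refine add_mem (sub_mem (sub_mem (zero_mem _) (Submodule.smul_mem _ _ ?_))
    (Submodule.smul_mem _ _ ?_)) (Submodule.smul_mem _ _ ?_)
  all_goals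
    rcases hm with rfl | rfl | rfl <;>
    simp only [lie_self, han, hah, hha, hhn, hna, hnh, neg_mem_iff, zero_mem, hamem, hhmem, hnmem]

end Lie

/-- On a simple real Lie algebra of dimension greater than 3 with a Lorentzian
left-invariant metric `B`, if `z ≠ 0` and `ad z` is skew-symmetric w.r.t. `B`,
then `ad z` is not nilpotent. -/
theorem stmt7 {L : Type*} [LieRing L] [LieAlgebra ℝ L] [Module.Finite ℝ L]
    [LieAlgebra.IsSimple ℝ L]
    (hdim : 3 < Module.finrank ℝ L)
    (B : LinearMap.BilinForm ℝ L) (hB : IsLorentzian B)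
    (z : L) (hz : z ≠ 0)
    (hskew : ∀ x y : L, B ⁅z, x⁆ y + B x ⁅z, y⁆ = 0) :
    ¬ IsNilpotent (LieAlgebra.ad ℝ L z) := by
  intro hnil
  have had : LieAlgebra.ad ℝ L z ≠ 0 := by
    intro h0
    have htop := LieAlgebra.IsSimple.span_eq_top (K := ℝ) (Set.mem_singleton z) hz (by
      rintro x _ rfl
      rw [← lie_skew, ← LieAlgebra.ad_apply (R := ℝ), h0]
      simp)
    have hle := finrank_span_singleton (K := ℝ) hz
    rw [htop, finrank_top] at hle
    omega
  obtain ⟨a, hn0, hn, hrange⟩ := hB.exists_jordan_chain_of_skew hskew hnil had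
  obtain ⟨n, h, b, hn0, hhn, hbn, hrange⟩ :=
    LieAlgebra.IsSimple.exists_normalized_of_jordan_chain (by omega) hn0 hn hrange
  obtain ⟨a, hideal⟩ := exists_span_triple_ideal hn0 hhn hbn hrange
  have htop := LieAlgebra.IsSimple.span_eq_top (K := ℝ) (y := n) (by simp) hn0 hideal
  classical
  have hle := finrank_span_finset_le_card (R := ℝ) ({a, h, n} : Finset L)
  rw [Finset.coe_insert, Finset.coe_pair, Set.finrank, htop, finrank_top] at hle
  have := hle.trans Finset.card_le_three
  omega
end

section
/- Let 𝔤 be a real semisimple Lie algebra with Killing form K and B a Lorentzian form with B(x,y) = K(x, Ay) for a K-symmetric isomorphism A. For a nonzero x in the null cone Λ* = {x ≠ 0 : K(x, A⁻¹x) = 0} lying also in a nilpotent adjoint orbit 𝒩 (with tangent space [x, 𝔤] at x), the cones Λ* and 𝒩 are transversal at x if and only if [x, A⁻¹x] ≠ 0. -/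
/-- The kernel of a nonzero linear form together with a subspace spans the whole space iff the
subspace is not contained in the kernel. -/
theorem LinearMap.ker_sup_eq_top_iff_not_le {K V : Type*} [Field K] [AddCommGroup V] [Module K V]
    {f : V →ₗ[K] K} (hf : f ≠ 0) (W : Submodule K V) :
    LinearMap.ker f ⊔ W = ⊤ ↔ ¬ W ≤ LinearMap.ker f := by
  have hco : IsCoatom (LinearMap.ker f) :=
    LinearMap.isCoatom_ker_of_surjective (LinearMap.surjective hf)
  constructor
  · intro h hle
    exact hco.1 (by rwa [sup_eq_left.mpr hle] at h)
  · intro h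
    exact hco.2 _ (left_lt_sup.mpr h)

/-- If `B` is symmetric for the Killing form, the tangent space `[x, 𝔤]` of the adjoint orbit lies
in the kernel of `K(x, B ·)` iff `x` commutes with `B x`. -/
theorem LieAlgebra.IsKilling.range_ad_le_ker_iff {K L : Type*} [Field K] [LieRing L]
    [LieAlgebra K L] [LieAlgebra.IsKilling K L] (B : L →ₗ[K] L)
    (hB : ∀ x y : L, killingForm K L (B x) y = killingForm K L x (B y)) (x : L) :
    LinearMap.range (LieAlgebra.ad K L x) ≤ LinearMap.ker ((killingForm K L x) ∘ₗ B) ↔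
      ⁅x, B x⁆ = 0 := by
  have key (y : L) : killingForm K L x (B ⁅x, y⁆) = killingForm K L ⁅B x, x⁆ y := by
    rw [← hB, LieModule.traceForm_apply_lie_apply]
  have hle : LinearMap.range (LieAlgebra.ad K L x) ≤ LinearMap.ker ((killingForm K L x) ∘ₗ B) ↔
      ∀ y, killingForm K L ⁅B x, x⁆ y = 0 := by
    rw [LinearMap.range_le_ker_iff, LinearMap.ext_iff]
    simp [key]
  rw [hle, ← lie_skew x (B x), neg_eq_zero]
  exact ⟨(LieAlgebra.IsKilling.killingForm_nondegenerate K L).1 _, fun h y => by simp [h]⟩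


/-- For a nonzero nilpotent `x` in the null cone (`K(x, A⁻¹x) = 0`), the tangent space
`{y : K(x, A⁻¹y) = 0}` to the null cone and the tangent space `[x, 𝔤]` to the adjoint
(nilpotent) orbit span the whole Lie algebra (transversality) iff `[x, A⁻¹x] ≠ 0`. -/
theorem stmt14 {L : Type*} [LieRing L] [LieAlgebra ℝ L] [Module.Finite ℝ L]
    [LieAlgebra.IsSemisimple ℝ L]
    (A : L ≃ₗ[ℝ] L)
    (hAsymm : ∀ x y : L, killingForm ℝ L (A x) y = killingForm ℝ L x (A y))
    (x : L) (hx : x ≠ 0)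
    (hnull : killingForm ℝ L x (A.symm x) = 0)
    (hnilp : IsNilpotent (LieAlgebra.ad ℝ L x)) :
    (LinearMap.ker ((killingForm ℝ L x) ∘ₗ A.symm.toLinearMap) ⊔
        LinearMap.range (LieAlgebra.ad ℝ L x) = ⊤) ↔
      ⁅x, A.symm x⁆ ≠ 0 := by
  have hsymm (u v : L) : killingForm ℝ L (A.symm u) v = killingForm ℝ L u (A.symm v) := by
    simpa using (hAsymm (A.symm u) (A.symm v)).symm
  have hne : (killingForm ℝ L x) ∘ₗ A.symm.toLinearMap ≠ 0 := by
    intro h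
    refine hx ((LieAlgebra.IsKilling.killingForm_nondegenerate ℝ L).1 x fun y => ?_)
    simpa using LinearMap.congr_fun h (A y)
  rw [LinearMap.ker_sup_eq_top_iff_not_le hne, ne_eq]
  exact not_congr (LieAlgebra.IsKilling.range_ad_le_ker_iff A.symm.toLinearMap hsymm x)
end

section
/- For 𝔤 = sl₂(ℂ) as a real Lie algebra with the basis and isomorphism A⁻¹ = diag(1,1,2,−3,−3,1) as above, every solution of the Euler equation u' = [u, A⁻¹u] has bounded coordinates, hence is complete: the coefficient α₃(t) of the timelike basis vector e₃ is constant along any solution, and the first integral K(u, A⁻¹u) = x₁² + x₂² − 2x₃² + 3y₁² + 3y₂² + y₃² then bounds the remaining coordinates. -/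
attribute [local instance] Matrix.normedAddCommGroup Matrix.normedSpace

/-- `e₁ = (1/√2)·diag(1,−1)` in `sl₂(ℂ)` (as a 2×2 complex matrix). -/
noncomputable def e1 : Matrix (Fin 2) (Fin 2) ℂ :=
  ((Real.sqrt 2 : ℂ))⁻¹ • !![1, 0; 0, -1]

/-- `e₂ = (1/√2)·offdiag(1,1)`. -/
noncomputable def e2 : Matrix (Fin 2) (Fin 2) ℂ :=
  ((Real.sqrt 2 : ℂ))⁻¹ • !![0, 1; 1, 0]

/-- `e₃ = (1/√2)·offdiag(1,−1)`. -/
noncomputable def e3 : Matrix (Fin 2) (Fin 2) ℂ :=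
  ((Real.sqrt 2 : ℂ))⁻¹ • !![0, 1; -1, 0]

/-- The element of `sl₂(ℂ)` (as a real Lie algebra) with real coordinates
`α` w.r.t. `{e₁,e₂,e₃}` and `β` w.r.t. `{ie₁,ie₂,ie₃}`. -/
noncomputable def elt (α β : Fin 3 → ℝ) : Matrix (Fin 2) (Fin 2) ℂ :=
  α 0 • e1 + α 1 • e2 + α 2 • e3 +
    β 0 • (Complex.I • e1) + β 1 • (Complex.I • e2) + β 2 • (Complex.I • e3)

/-- The image under `A⁻¹ = diag(1, 1, 2, −3, −3, 1)` (in the real basis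
`{e₁,e₂,e₃,ie₁,ie₂,ie₃}`) of the element with coordinates `(α, β)`. -/
noncomputable def AinvElt (α β : Fin 3 → ℝ) : Matrix (Fin 2) (Fin 2) ℂ :=
  elt (fun i => ![1, 1, 2] i * α i) (fun i => ![-3, -3, 1] i * β i)

/-- The `{e₁, e₂, e₃}`-coordinates of `⁅u, A⁻¹u⁆`. -/
noncomputable def eulerRe (α β : Fin 3 → ℝ) : Fin 3 → ℝ :=
  ![√2 * (4 * β 1 * β 2 - α 1 * α 2), √2 * (α 0 * α 2 - 4 * β 0 * β 2), 0]

/-- The `{ie₁, ie₂, ie₃}`-coordinates of `⁅u, A⁻¹u⁆`. -/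
noncomputable def eulerIm (α β : Fin 3 → ℝ) : Fin 3 → ℝ :=
  ![-(5 * √2 * α 2 * β 1), 5 * √2 * α 2 * β 0, 4 * √2 * (α 1 * β 0 - α 0 * β 1)]

lemma elt_eq (α β : Fin 3 → ℝ) :
    elt α β = !![(√2 : ℂ)⁻¹ * ⟨α 0, β 0⟩, (√2 : ℂ)⁻¹ * ⟨α 1 + α 2, β 1 + β 2⟩;
      (√2 : ℂ)⁻¹ * ⟨α 1 - α 2, β 1 - β 2⟩, -((√2 : ℂ)⁻¹ * ⟨α 0, β 0⟩)] := by
  ext i j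
  fin_cases i <;> fin_cases j <;>
    simp [elt, e1, e2, e3, Complex.mk_eq_add_mul_I] <;> ring

lemma lie_elt_AinvElt (α β : Fin 3 → ℝ) :
    ⁅elt α β, AinvElt α β⁆ = elt (eulerRe α β) (eulerIm α β) := by
  have hs : (√2 : ℂ) ^ 2 = 2 := by
    rw [← Complex.ofReal_pow, Real.sq_sqrt (by norm_num)]; norm_num
  have hs0 : (√2 : ℂ) ≠ 0 := by
    intro h; rw [h] at hs; norm_num at hs
  rw [AinvElt, elt_eq, elt_eq, elt_eq, Ring.lie_def]
  ext i j
  fin_cases i <;> fin_cases j <;>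
    simp [eulerRe, eulerIm, Complex.mk_eq_add_mul_I] <;>
    field_simp <;> simp only [hs] <;> ring_nf <;>
    simp only [Complex.I_sq] <;> ring

lemma Complex.hasDerivAt_mk_iff {f g : ℝ → ℝ} {a b t : ℝ} :
    HasDerivAt (fun τ => (⟨f τ, g τ⟩ : ℂ)) ⟨a, b⟩ t ↔ HasDerivAt f a t ∧ HasDerivAt g b t := by
  constructor
  · intro h
    exact ⟨Complex.reCLM.hasFDerivAt.comp_hasDerivAt t h,
      Complex.imCLM.hasFDerivAt.comp_hasDerivAt t h⟩
  · rintro ⟨hf, hg⟩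
    simp only [Complex.mk_eq_add_mul_I]
    exact hf.ofReal_comp.add (hg.ofReal_comp.mul_const _)

lemma hasDerivAt_of_add_of_sub {f g : ℝ → ℝ} {a b t : ℝ}
    (hadd : HasDerivAt (fun τ => f τ + g τ) (a + b) t)
    (hsub : HasDerivAt (fun τ => f τ - g τ) (a - b) t) :
    HasDerivAt f a t ∧ HasDerivAt g b t := by
  have hf : f = fun τ => (f τ + g τ + (f τ - g τ)) / 2 := by
    ext τ
    ring
  have hg : g = fun τ => (f τ + g τ - (f τ - g τ)) / 2 := by
    ext τ
    ring
  constructor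
  · rw [hf]
    exact ((hadd.add hsub).div_const 2).congr_deriv (by ring)
  · rw [hg]
    exact ((hadd.sub hsub).div_const 2).congr_deriv (by ring)

lemma hasDerivAt_elt_iff {α β : ℝ → Fin 3 → ℝ} {a b : Fin 3 → ℝ} {t : ℝ} :
    HasDerivAt (fun τ => elt (α τ) (β τ)) (elt a b) t ↔
      (∀ i, HasDerivAt (fun τ => α τ i) (a i) t) ∧
        ∀ i, HasDerivAt (fun τ => β τ i) (b i) t := by
  constructor
  · intro h
    have hentry (i j : Fin 2) :
        HasDerivAt (fun τ => (√2 : ℂ) * elt (α τ) (β τ) i j) (√2 * elt a b i j) t :=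
      (hasDerivAt_pi.1 (hasDerivAt_pi.1 h i) j).const_mul _
    have h00 := hentry 0 0
    have h01 := hentry 0 1
    have h10 := hentry 1 0
    have hs0 : (√2 : ℂ) ≠ 0 := by simp
    simp only [elt_eq, Matrix.of_apply, Matrix.cons_val_zero, Matrix.cons_val_one,
      Matrix.cons_val', Matrix.cons_val_fin_one, mul_inv_cancel_left₀ hs0] at h00 h01 h10
    rw [Complex.hasDerivAt_mk_iff] at h00 h01 h10
    obtain ⟨hα₁, hα₂⟩ := hasDerivAt_of_add_of_sub h01.1 h10.1
    obtain ⟨hβ₁, hβ₂⟩ := hasDerivAt_of_add_of_sub h01.2 h10.2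
    exact ⟨Fin.forall_fin_succ.2 ⟨h00.1, Fin.forall_fin_two.2 ⟨hα₁, hα₂⟩⟩,
      Fin.forall_fin_succ.2 ⟨h00.2, Fin.forall_fin_two.2 ⟨hβ₁, hβ₂⟩⟩⟩
  · rintro ⟨hα, hβ⟩
    exact ((((((hα 0).smul_const e1).add ((hα 1).smul_const e2)).add
      ((hα 2).smul_const e3)).add ((hβ 0).smul_const _)).add
      ((hβ 1).smul_const _)).add ((hβ 2).smul_const _)

/-- The Euler equation, written for `X = x₁ + i x₂`, `x₃`, `Y = y₁ + i y₂` and `y₃`. -/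
lemma hasDerivAt_euler_iff {α β : ℝ → Fin 3 → ℝ} {t : ℝ} :
    HasDerivAt (fun τ => elt (α τ) (β τ)) ⁅elt (α t) (β t), AinvElt (α t) (β t)⁆ t ↔
      HasDerivAt (fun τ => (⟨α τ 0, α τ 1⟩ : ℂ))
        (√2 * Complex.I * (α t 2 * ⟨α t 0, α t 1⟩ - 4 * β t 2 * ⟨β t 0, β t 1⟩)) t ∧
      HasDerivAt (fun τ => α τ 2) 0 t ∧
      HasDerivAt (fun τ => (⟨β τ 0, β τ 1⟩ : ℂ))
        (5 * √2 * α t 2 * Complex.I * ⟨β t 0, β t 1⟩) t ∧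
      HasDerivAt (fun τ => β τ 2)
        (4 * √2 * ((⟨α t 0, α t 1⟩ : ℂ) * star (⟨β t 0, β t 1⟩ : ℂ)).im) t := by
  have hX : (√2 * Complex.I * (α t 2 * ⟨α t 0, α t 1⟩ - 4 * β t 2 * ⟨β t 0, β t 1⟩) : ℂ) =
      ⟨eulerRe (α t) (β t) 0, eulerRe (α t) (β t) 1⟩ := by
    apply Complex.ext <;> simp [eulerRe] <;> ring
  have hY : (5 * √2 * α t 2 * Complex.I * ⟨β t 0, β t 1⟩ : ℂ) =
      ⟨eulerIm (α t) (β t) 0, eulerIm (α t) (β t) 1⟩ := by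
    apply Complex.ext <;> simp [eulerIm]
  have hr : 4 * √2 * ((⟨α t 0, α t 1⟩ : ℂ) * star (⟨β t 0, β t 1⟩ : ℂ)).im =
      eulerIm (α t) (β t) 2 := by
    simp [eulerIm]; ring
  have h0 : (0 : ℝ) = eulerRe (α t) (β t) 2 := by simp [eulerRe]
  rw [lie_elt_AinvElt, hasDerivAt_elt_iff, hX, hY, hr, h0, Complex.hasDerivAt_mk_iff,
    Complex.hasDerivAt_mk_iff]
  simp only [Fin.forall_fin_succ, Fin.succ_zero_eq_one,
    Fin.succ_one_eq_two, IsEmpty.forall_iff, and_true]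
  tauto

lemma Set.OrdConnected.eq_of_hasDerivAt_zero {E : Type*} [NormedAddCommGroup E]
    [NormedSpace ℝ E] {I : Set ℝ} (hI : I.OrdConnected) {f : ℝ → E}
    (hf : ∀ t ∈ I, HasDerivAt f 0 t) {s t : ℝ} (hs : s ∈ I) (ht : t ∈ I) : f s = f t := by
  have h := hI.convex.norm_image_sub_le_of_norm_hasDerivWithin_le (C := 0)
    (fun x hx => (hf x hx).hasDerivWithinAt) (by simp) ht hs
  simpa [sub_eq_zero] using h

lemma hasDerivAt_exp_sub_smul_apply {E : Type*} [NormedAddCommGroup E] [NormedSpace ℝ E]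
    [CompleteSpace E] (M : E →L[ℝ] E) (v : E) (s t : ℝ) :
    HasDerivAt (fun τ => NormedSpace.exp ((τ - s) • M) v)
      (M (NormedSpace.exp ((t - s) • M) v)) t := by
  have h := (hasDerivAt_exp_smul_const' (𝕂 := ℝ) M (t - s)).comp_sub_const t s
  simpa using h.clm_apply (hasDerivAt_const t v)

/-- Uniqueness for autonomous linear equations on an interval. -/
lemma Set.OrdConnected.eq_exp_of_hasDerivAt {E : Type*} [NormedAddCommGroup E]
    [NormedSpace ℝ E] [CompleteSpace E] {I : Set ℝ} (hI : I.OrdConnected) (M : E →L[ℝ] E)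
    {v : ℝ → E} (hv : ∀ t ∈ I, HasDerivAt v (M (v t)) t) {s t : ℝ} (hs : s ∈ I) (ht : t ∈ I) :
    v t = NormedSpace.exp ((t - s) • M) (v s) := by
  have hconst : ∀ τ ∈ I, HasDerivAt (fun τ => NormedSpace.exp ((τ - t) • -M) (v τ)) 0 τ := by
    intro τ hτ
    have h := (hasDerivAt_exp_smul_const (𝕂 := ℝ) (-M) (τ - t)).comp_sub_const τ t
    simpa using h.clm_apply (hv τ hτ)
  have h := hI.eq_of_hasDerivAt_zero hconst hs ht
  have hneg : (s - t) • -M = (t - s) • M := by rw [smul_neg, ← neg_smul, neg_sub]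
  simpa [hneg] using h.symm

/-- The constant-coefficient linear equation satisfied by `(x₁ + i x₂, y₃)` in the frame
rotating with `y₁ + i y₂`, where `c = x₃` and `η` is the initial value of `y₁ + i y₂`. -/
noncomputable def rotatingField (c : ℝ) (η : ℂ) : ℂ × ℝ →L[ℝ] ℂ × ℝ :=
  LinearMap.toContinuousLinearMap
    { toFun := fun v => (-4 * √2 * Complex.I * (c * v.1 + v.2 * η), 4 * √2 * (v.1 * star η).im)
      map_add' := by
        intro v w
        ext <;> simp <;> ring
      map_smul' := by
        intro r v
        ext <;> simp <;> ring }

lemma rotatingField_apply (c : ℝ) (η : ℂ) (v : ℂ × ℝ) :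
    rotatingField c η v =
      (-4 * √2 * Complex.I * (c * v.1 + v.2 * η), 4 * √2 * (v.1 * star η).im) := rfl

/-- The phase `exp (5√2 c (t - s) i)`. -/
noncomputable def phase (c s t : ℝ) : ℂ :=
  Complex.exp (5 * √2 * c * (t - s) * Complex.I)

lemma phase_self (c s : ℝ) : phase c s s = 1 := by simp [phase]

lemma phase_neg_mul (c s t : ℝ) : phase (-c) s t * phase c s t = 1 := by
  rw [phase, phase, ← Complex.exp_add]
  simp

lemma star_phase (c s t : ℝ) : star (phase c s t) = phase (-c) s t := by
  rw [phase, Complex.star_def, ← Complex.exp_conj, phase]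
  simp [Complex.conj_ofNat]

lemma hasDerivAt_phase (c s t : ℝ) :
    HasDerivAt (phase c s) (5 * √2 * c * Complex.I * phase c s t) t := by
  have h : HasDerivAt (fun τ : ℝ => (5 * √2 * c * (τ - s) * Complex.I : ℂ))
      (5 * √2 * c * Complex.I) t := by
    simpa using ((((hasDerivAt_id t).ofReal_comp).sub_const (s : ℂ)).const_mul
      (5 * √2 * c : ℂ)).mul_const Complex.I
  exact h.cexp.congr_deriv (mul_comm _ _)


/-- The global solution of the Euler equation with `x₃ = c`, whose remaining coordinates at
time `s` are `x₁ + i x₂ = v.1`, `y₁ + i y₂ = η` and `y₃ = v.2`. -/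
lemma hasDerivAt_euler_of_rotatingField (c s : ℝ) (η : ℂ) (v : ℂ × ℝ) {α β : ℝ → Fin 3 → ℝ}
    (hX : ∀ t, (⟨α t 0, α t 1⟩ : ℂ) =
      phase c s t * (NormedSpace.exp ((t - s) • rotatingField c η) v).1)
    (hc : ∀ t, α t 2 = c)
    (hY : ∀ t, (⟨β t 0, β t 1⟩ : ℂ) = phase c s t * η)
    (hr : ∀ t, β t 2 = (NormedSpace.exp ((t - s) • rotatingField c η) v).2) (t : ℝ) :
    HasDerivAt (fun τ => elt (α τ) (β τ)) ⁅elt (α t) (β t), AinvElt (α t) (β t)⁆ t := by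
  have hw := hasDerivAt_exp_sub_smul_apply (rotatingField c η) v s t
  rw [rotatingField_apply] at hw
  rw [hasDerivAt_euler_iff]
  simp only [hX, hc, hY, hr]
  refine ⟨?_, hasDerivAt_const t c, ?_, ?_⟩
  · refine ((hasDerivAt_phase c s t).mul hw.fst).congr_deriv ?_
    ring
  · refine ((hasDerivAt_phase c s t).mul_const η).congr_deriv ?_
    ring
  · refine ((hasFDerivAt_snd (𝕜 := ℝ)).comp_hasDerivAt t hw).congr_deriv
      (congrArg (fun z : ℂ => 4 * √2 * z.im) ?_)
    rw [star_mul', star_phase]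
    linear_combination -(NormedSpace.exp ((t - s) • rotatingField c η) v).1 * star η *
      phase_neg_mul c s t

section Solution

variable {I : Set ℝ} {α β : ℝ → Fin 3 → ℝ}

lemma euler_timelike_const (hI : I.OrdConnected)
    (hu : ∀ t ∈ I, HasDerivAt (fun τ => elt (α τ) (β τ))
      ⁅elt (α t) (β t), AinvElt (α t) (β t)⁆ t) {s t : ℝ} (hs : s ∈ I) (ht : t ∈ I) :
    α s 2 = α t 2 :=
  hI.eq_of_hasDerivAt_zero (f := fun τ => α τ 2)
    (fun τ hτ => (hasDerivAt_euler_iff.1 (hu τ hτ)).2.1) hs ht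

lemma euler_energy_const (hI : I.OrdConnected)
    (hu : ∀ t ∈ I, HasDerivAt (fun τ => elt (α τ) (β τ))
      ⁅elt (α t) (β t), AinvElt (α t) (β t)⁆ t) {s t : ℝ} (hs : s ∈ I) (ht : t ∈ I) :
    (α s 0) ^ 2 + (α s 1) ^ 2 - 2 * (α s 2) ^ 2 +
        3 * (β s 0) ^ 2 + 3 * (β s 1) ^ 2 + (β s 2) ^ 2 =
      (α t 0) ^ 2 + (α t 1) ^ 2 - 2 * (α t 2) ^ 2 +
        3 * (β t 0) ^ 2 + 3 * (β t 1) ^ 2 + (β t 2) ^ 2 := by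
  refine hI.eq_of_hasDerivAt_zero (f := fun τ => (α τ 0) ^ 2 + (α τ 1) ^ 2 - 2 * (α τ 2) ^ 2 +
    3 * (β τ 0) ^ 2 + 3 * (β τ 1) ^ 2 + (β τ 2) ^ 2) (fun τ hτ => ?_) hs ht
  have h := hu τ hτ
  rw [lie_elt_AinvElt, hasDerivAt_elt_iff] at h
  obtain ⟨hα, hβ⟩ := h
  refine (((((((hα 0).pow 2).add ((hα 1).pow 2)).sub (((hα 2).pow 2).const_mul 2)).add
    (((hβ 0).pow 2).const_mul 3)).add (((hβ 1).pow 2).const_mul 3)).add ((hβ 2).pow 2)).congr_deriv ?_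
  simp [eulerRe, eulerIm]
  ring

lemma euler_bounded (hI : I.OrdConnected)
    (hu : ∀ t ∈ I, HasDerivAt (fun τ => elt (α τ) (β τ))
      ⁅elt (α t) (β t), AinvElt (α t) (β t)⁆ t) {s : ℝ} (hs : s ∈ I) :
    ∃ C : ℝ, ∀ t ∈ I, ∀ i : Fin 3, |α t i| ≤ C ∧ |β t i| ≤ C := by
  refine ⟨√((α s 0) ^ 2 + (α s 1) ^ 2 + (α s 2) ^ 2 +
    3 * (β s 0) ^ 2 + 3 * (β s 1) ^ 2 + (β s 2) ^ 2), fun t ht i => ?_⟩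
  have hc := euler_timelike_const hI hu hs ht
  have hK := euler_energy_const hI hu hs ht
  rw [hc] at hK ⊢
  constructor <;> apply Real.abs_le_sqrt <;> fin_cases i <;> simp only [Fin.zero_eta,
    Fin.mk_one, Fin.reduceFinMk] <;>
    linarith [sq_nonneg (α t 0), sq_nonneg (α t 1), sq_nonneg (α t 2), sq_nonneg (β t 0),
      sq_nonneg (β t 1), sq_nonneg (β t 2)]

lemma euler_transverse_eq (hI : I.OrdConnected)
    (hu : ∀ t ∈ I, HasDerivAt (fun τ => elt (α τ) (β τ))
      ⁅elt (α t) (β t), AinvElt (α t) (β t)⁆ t) {s t : ℝ} (hs : s ∈ I) (ht : t ∈ I) :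
    (⟨β t 0, β t 1⟩ : ℂ) = phase (α s 2) s t * ⟨β s 0, β s 1⟩ := by
  have hconst : ∀ τ ∈ I, HasDerivAt
      (fun τ => phase (-α s 2) s τ * (⟨β τ 0, β τ 1⟩ : ℂ)) 0 τ := by
    intro τ hτ
    refine ((hasDerivAt_phase (-α s 2) s τ).mul
      (hasDerivAt_euler_iff.1 (hu τ hτ)).2.2.1).congr_deriv ?_
    rw [euler_timelike_const hI hu hτ hs]
    push_cast
    ring
  have h := hI.eq_of_hasDerivAt_zero hconst ht hs
  rw [phase_self, one_mul] at h
  rw [← h, ← mul_assoc, mul_comm (phase _ _ _), phase_neg_mul, one_mul]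

lemma euler_eq_exp (hI : I.OrdConnected)
    (hu : ∀ t ∈ I, HasDerivAt (fun τ => elt (α τ) (β τ))
      ⁅elt (α t) (β t), AinvElt (α t) (β t)⁆ t) {s t : ℝ} (hs : s ∈ I) (ht : t ∈ I) :
    ((phase (-α s 2) s t * ⟨α t 0, α t 1⟩, β t 2) : ℂ × ℝ) =
      NormedSpace.exp ((t - s) • rotatingField (α s 2) ⟨β s 0, β s 1⟩)
        (⟨α s 0, α s 1⟩, β s 2) := by
  have hv : ∀ τ ∈ I, HasDerivAt
      (fun τ => ((phase (-α s 2) s τ * ⟨α τ 0, α τ 1⟩, β τ 2) : ℂ × ℝ))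
      (rotatingField (α s 2) ⟨β s 0, β s 1⟩
        (phase (-α s 2) s τ * ⟨α τ 0, α τ 1⟩, β τ 2)) τ := by
    intro τ hτ
    obtain ⟨hX, -, -, hr⟩ := hasDerivAt_euler_iff.1 (hu τ hτ)
    refine (((hasDerivAt_phase (-α s 2) s τ).mul hX).prodMk hr).congr_deriv ?_
    rw [rotatingField_apply, euler_transverse_eq hI hu hs hτ, euler_timelike_const hI hu hτ hs]
    refine Prod.ext ?_ ?_
    · push_cast
      linear_combination (-4 * √2 * Complex.I * β τ 2 * (⟨β s 0, β s 1⟩ : ℂ)) *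
        phase_neg_mul (α s 2) s τ
    · rw [star_mul', star_phase]
      ring_nf
  simpa [phase_self] using hI.eq_exp_of_hasDerivAt _ hv hs ht

end Solution

/-- Every solution of the Euler equation `u' = [u, A⁻¹u]` on `sl₂(ℂ)` with
`A⁻¹ = diag(1,1,2,−3,−3,1)`: the coefficient `α₃` of the timelike basis vector `e₃`
is constant, the first integral `x₁² + x₂² − 2x₃² + 3y₁² + 3y₂² + y₃²` is constant,
all coordinates are bounded, and hence the solution is complete (it extends to a
solution defined on all of `ℝ`). -/
theorem stmt18 (I : Set ℝ) (hI : I.OrdConnected) (hne : I.Nonempty)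
    (α β : ℝ → Fin 3 → ℝ)
    (hu : ∀ t ∈ I, HasDerivAt (fun τ => elt (α τ) (β τ))
      ⁅elt (α t) (β t), AinvElt (α t) (β t)⁆ t) :
    (∀ s ∈ I, ∀ t ∈ I, α s 2 = α t 2) ∧
    (∀ s ∈ I, ∀ t ∈ I,
      (α s 0) ^ 2 + (α s 1) ^ 2 - 2 * (α s 2) ^ 2 +
          3 * (β s 0) ^ 2 + 3 * (β s 1) ^ 2 + (β s 2) ^ 2 =
        (α t 0) ^ 2 + (α t 1) ^ 2 - 2 * (α t 2) ^ 2 +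
          3 * (β t 0) ^ 2 + 3 * (β t 1) ^ 2 + (β t 2) ^ 2) ∧
    (∃ C : ℝ, ∀ t ∈ I, ∀ i : Fin 3, |α t i| ≤ C ∧ |β t i| ≤ C) ∧
    (∃ α' β' : ℝ → Fin 3 → ℝ,
      (∀ t : ℝ, HasDerivAt (fun τ => elt (α' τ) (β' τ))
        ⁅elt (α' t) (β' t), AinvElt (α' t) (β' t)⁆ t) ∧
      ∀ t ∈ I, α' t = α t ∧ β' t = β t) := by
  obtain ⟨s, hs⟩ := hne
  refine ⟨fun _ hs _ ht => euler_timelike_const hI hu hs ht,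
    fun _ hs _ ht => euler_energy_const hI hu hs ht, euler_bounded hI hu hs, ?_⟩
  set η : ℂ := ⟨β s 0, β s 1⟩
  set w : ℝ → ℂ × ℝ := fun t => NormedSpace.exp ((t - s) • rotatingField (α s 2) η)
    (⟨α s 0, α s 1⟩, β s 2)
  refine ⟨fun t => ![(phase (α s 2) s t * (w t).1).re, (phase (α s 2) s t * (w t).1).im, α s 2],
    fun t => ![(phase (α s 2) s t * η).re, (phase (α s 2) s t * η).im, (w t).2],
    hasDerivAt_euler_of_rotatingField (α s 2) s η (⟨α s 0, α s 1⟩, β s 2)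
      (fun t => rfl) (fun t => rfl) (fun t => rfl) (fun t => rfl), fun t ht => ?_⟩
  have hwt : w t = (phase (-α s 2) s t * ⟨α t 0, α t 1⟩, β t 2) :=
    (euler_eq_exp hI hu hs ht).symm
  have hX : phase (α s 2) s t * (w t).1 = ⟨α t 0, α t 1⟩ := by
    rw [hwt, ← mul_assoc, mul_comm (phase _ _ _), phase_neg_mul, one_mul]
  have hY : phase (α s 2) s t * η = ⟨β t 0, β t 1⟩ := (euler_transverse_eq hI hu hs ht).symm
  constructor <;> ext i <;> fin_cases i
  · simp [hX]
  · simp [hX]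
  · simpa using euler_timelike_const hI hu hs ht
  · simp [hY]
  · simp [hY]
  · simp [hwt]
end
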